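/- The Bellman update preserves monotonicity (induction step in the relative value iteration proof of Lemma 2): if V : X → ℝ is monotone with respect to ⪯, then the function X ↦ min_{w∈W} J_V(X, w) is also monotone with respect to ⪯. -/

import Mathlib

namespace AoI

/-- Per-device control action: idle `(0,0)`, continue the current in-transmission
update `(1,1)`, or sample and transmit a new update `(1,2)`. -/
inductive Act : Type
  | idle : Act
  | cont : Act
  | new  : Act
  deriving DecidableEq

instance : Fintype Act :=
  ⟨{Act.idle, Act.cont, Act.new}, by intro a; cases a <;> simp⟩

/-- Per-device state `(A_d, A_r, D)`. -/
abbrev S : Type := ℕ × ℕ × ℕ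

/-- Success successor under action `(1,1)`. -/
def sCont (L Ahd Ahr : ℕ) (x : S) : S :=
  if x.2.2 = 1 then (0, min (x.1 + 1) Ahr, L)
  else (min (x.1 + 1) Ahd, min (x.2.1 + 1) Ahr, x.2.2 - 1)

/-- Failure successor under `(1,1)`; this is also the unscheduled successor
`X_{k,un}` under action `(0,0)`. -/
def fCont (Ahd Ahr : ℕ) (x : S) : S :=
  (min (x.1 + 1) Ahd, min (x.2.1 + 1) Ahr, x.2.2)

/-- Success successor under action `(1,2)`. -/
def sNew (L Ahr : ℕ) (x : S) : S := (1, min (x.2.1 + 1) Ahr, L - 1)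

/-- Failure successor under action `(1,2)`. -/
def fNew (L Ahr : ℕ) (x : S) : S := (0, min (x.2.1 + 1) Ahr, L)

/-- Per-device transition kernel `P_k(x' | x, a)`. -/
def Pk (lam : ℝ) (L Ahd Ahr : ℕ) (x x' : S) : Act → ℝ
  | Act.idle => if x' = fCont Ahd Ahr x then 1 else 0
  | Act.cont =>
      (if x' = sCont L Ahd Ahr x then lam else 0) +
        (if x' = fCont Ahd Ahr x then 1 - lam else 0)
  | Act.new =>
      (if x' = sNew L Ahr x then lam else 0) +
        (if x' = fNew L Ahr x then 1 - lam else 0)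

/-- Per-device state space `{0,…,Âd} × {0,…,Âr} × {1,…,L}`. -/
def spaceS (L Ahd Ahr : ℕ) : Finset S :=
  Finset.range (Ahd + 1) ×ˢ (Finset.range (Ahr + 1) ×ˢ Finset.Icc 1 L)

/-- Joint state space `X = X_1 × ⋯ × X_K`. -/
def jointSpace {K : ℕ} (L Ahd Ahr : Fin K → ℕ) : Finset (Fin K → S) :=
  Fintype.piFinset fun k => spaceS (L k) (Ahd k) (Ahr k)

/-- Joint transition kernel `P(X' | X, w) = ∏ₖ P_k(X'_k | X_k, w_k)`. -/
def Pjoint {K : ℕ} (lam : Fin K → ℝ) (L Ahd Ahr : Fin K → ℕ)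
    (x x' : Fin K → S) (w : Fin K → Act) : ℝ :=
  ∏ k, Pk (lam k) (L k) (Ahd k) (Ahr k) (x k) (x' k) (w k)

/-- Feasible joint actions: at most `M` devices are scheduled. -/
def feasible (K M : ℕ) : Finset (Fin K → Act) :=
  Finset.univ.filter fun w => (Finset.univ.filter fun k => w k ≠ Act.idle).card ≤ M

lemma feasible_nonempty (K M : ℕ) : (feasible K M).Nonempty := by
  refine ⟨fun _ => Act.idle, Finset.mem_filter.mpr ⟨Finset.mem_univ _, ?_⟩⟩
  simp

/-- The state–action cost `J_V(X, w) = Σₖ A_{r,k} + Σ_{X'∈X} P(X'|X,w) V(X')`. -/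
def J {K : ℕ} (lam : Fin K → ℝ) (L Ahd Ahr : Fin K → ℕ)
    (V : (Fin K → S) → ℝ) (x : Fin K → S) (w : Fin K → Act) : ℝ :=
  (∑ k, ((x k).2.1 : ℝ)) +
    ∑ x' ∈ jointSpace L Ahd Ahr, Pjoint lam L Ahd Ahr x x' w * V x'

/-- Componentwise order on per-device states:
`(A¹_d, A¹_r, D¹) ⪯ (A²_d, A²_r, D²)` iff `A¹_d ≤ A²_d`, `A¹_r ≤ A²_r`, `D¹ = D²`. -/
def xleS (x y : S) : Prop := x.1 ≤ y.1 ∧ x.2.1 ≤ y.2.1 ∧ x.2.2 = y.2.2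


/-- Successor of a device state under an action, indexed by the success of the transmission. -/
def succS (L Ahd Ahr : ℕ) (x : S) : Act → Bool → S
  | Act.idle, _ => fCont Ahd Ahr x
  | Act.cont, b => if b then sCont L Ahd Ahr x else fCont Ahd Ahr x
  | Act.new, b => if b then sNew L Ahr x else fNew L Ahr x

/-- Probability of success (`true`) or failure (`false`) of a transmission. -/
def outcomeProb (lam : ℝ) (b : Bool) : ℝ := if b then lam else 1 - lam

lemma outcomeProb_nonneg {lam : ℝ} (h0 : 0 ≤ lam) (h1 : lam ≤ 1) (b : Bool) :
    0 ≤ outcomeProb lam b := by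
  cases b <;> simp [outcomeProb, h0, h1]

lemma Pk_eq_sum (lam : ℝ) (L Ahd Ahr : ℕ) (x x' : S) (a : Act) :
    Pk lam L Ahd Ahr x x' a =
      ∑ b : Bool, if x' = succS L Ahd Ahr x a b then outcomeProb lam b else 0 := by
  cases a
  · by_cases h : x' = fCont Ahd Ahr x <;> simp [Pk, succS, outcomeProb, h]
  · simp [Pk, succS, outcomeProb]
  · simp [Pk, succS, outcomeProb]

lemma succS_mem {L Ahd Ahr : ℕ} (hL : 2 ≤ L) (hAd : 1 ≤ Ahd) {x : S}
    (hx : x ∈ spaceS L Ahd Ahr) (a : Act) (b : Bool) :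
    succS L Ahd Ahr x a b ∈ spaceS L Ahd Ahr := by
  obtain ⟨d, r, D⟩ := x
  simp only [spaceS, Finset.mem_product, Finset.mem_range, Finset.mem_Icc] at hx ⊢
  cases a <;> cases b <;> simp only [succS, fCont, sCont, sNew, fNew] <;> grind

lemma succS_mono (L Ahd Ahr : ℕ) {x y : S} (h : xleS x y) (a : Act) (b : Bool) :
    xleS (succS L Ahd Ahr x a b) (succS L Ahd Ahr y a b) := by
  obtain ⟨d, r, D⟩ := x
  obtain ⟨d', r', D'⟩ := y
  simp only [xleS] at h ⊢
  cases a <;> cases b <;> simp only [succS, fCont, sCont, sNew, fNew] <;> grind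

lemma Pjoint_eq_sum {K : ℕ} (lam : Fin K → ℝ) (L Ahd Ahr : Fin K → ℕ)
    (x x' : Fin K → S) (w : Fin K → Act) :
    Pjoint lam L Ahd Ahr x x' w =
      ∑ b : Fin K → Bool,
        if x' = fun k => succS (L k) (Ahd k) (Ahr k) (x k) (w k) (b k) then
          ∏ k, outcomeProb (lam k) (b k) else 0 := by
  simp only [Pjoint, Pk_eq_sum, Fintype.prod_sum, Finset.prod_ite_zero, Finset.mem_univ,
    true_imp_iff, funext_iff]

lemma J_eq_sum {K : ℕ} (lam : Fin K → ℝ) {L Ahd Ahr : Fin K → ℕ}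
    (hL : ∀ k, 2 ≤ L k) (hAd : ∀ k, 1 ≤ Ahd k) (V : (Fin K → S) → ℝ)
    {x : Fin K → S} (hx : x ∈ jointSpace L Ahd Ahr) (w : Fin K → Act) :
    J lam L Ahd Ahr V x w = (∑ k, ((x k).2.1 : ℝ)) +
      ∑ b : Fin K → Bool, (∏ k, outcomeProb (lam k) (b k)) *
        V fun k => succS (L k) (Ahd k) (Ahr k) (x k) (w k) (b k) := by
  simp only [J, Pjoint_eq_sum, Finset.sum_mul]
  rw [Finset.sum_comm]
  congr 1
  refine Finset.sum_congr rfl fun b _ => ?_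
  have hmem : (fun k => succS (L k) (Ahd k) (Ahr k) (x k) (w k) (b k)) ∈ jointSpace L Ahd Ahr :=
    Fintype.mem_piFinset.mpr fun k =>
      succS_mem (hL k) (hAd k) (Fintype.mem_piFinset.mp hx k) (w k) (b k)
  simp only [ite_mul, zero_mul, Finset.sum_ite_eq', hmem, if_true]

/-- the Bellman update preserves monotonicity: if `V` is monotone
w.r.t. `⪯` on the state space, so is `X ↦ min_{w ∈ W} J_V(X, w)`. -/
theorem bellman_update_preserves_monotonicity
    (K M : ℕ) (hK : 1 ≤ K) (hM1 : 1 ≤ M) (hM2 : M ≤ K)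
    (lam : Fin K → ℝ) (L Ahd Ahr : Fin K → ℕ)
    (hlam : ∀ k, 0 < lam k ∧ lam k ≤ 1)
    (hL : ∀ k, 2 ≤ L k) (hAd : ∀ k, 1 ≤ Ahd k) (hAr : ∀ k, 1 ≤ Ahr k)
    (V : (Fin K → S) → ℝ)
    (hV : ∀ x1 ∈ jointSpace L Ahd Ahr, ∀ x2 ∈ jointSpace L Ahd Ahr,
      (∀ k, xleS (x1 k) (x2 k)) → V x1 ≤ V x2) :
    ∀ x1 ∈ jointSpace L Ahd Ahr, ∀ x2 ∈ jointSpace L Ahd Ahr,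
      (∀ k, xleS (x1 k) (x2 k)) →
        (feasible K M).inf' (feasible_nonempty K M)
            (fun w => J lam L Ahd Ahr V x1 w) ≤
          (feasible K M).inf' (feasible_nonempty K M)
            (fun w => J lam L Ahd Ahr V x2 w) := by
  intro x1 hx1 x2 hx2 hle
  refine Finset.inf'_mono_fun fun w _ => ?_
  rw [J_eq_sum lam hL hAd V hx1, J_eq_sum lam hL hAd V hx2]
  refine add_le_add (Finset.sum_le_sum fun k _ => Nat.cast_le.mpr (hle k).2.1)
    (Finset.sum_le_sum fun b _ => mul_le_mul_of_nonneg_left ?_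
      (Finset.prod_nonneg fun k _ => outcomeProb_nonneg (hlam k).1.le (hlam k).2 _))
  have hmem {x : Fin K → S} (hx : x ∈ jointSpace L Ahd Ahr) :
      (fun k => succS (L k) (Ahd k) (Ahr k) (x k) (w k) (b k)) ∈ jointSpace L Ahd Ahr :=
    Fintype.mem_piFinset.mpr fun k =>
      succS_mem (hL k) (hAd k) (Fintype.mem_piFinset.mp hx k) (w k) (b k)
  exact hV _ (hmem hx1) _ (hmem hx2) fun k => succS_mono _ _ _ (hle k) _ _

end AoI
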